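/- arXiv:1907.01603 — 3 statements merged into one kernel-verified Lean document; each statement's English description precedes it below -/
import Mathlib

section
/- For all integers s > r ≥ 2 there exists a constant n₀ = n₀(r,s) such that for every n ≥ n₀, the minimum number of copies of K_r in an n-vertex K_s-saturated graph satisfies sat(n, K_r, K_s) = (n - s + 2)·C(s-2, r-1) + C(s-2, r). -/
open SimpleGraph Finset

variable {V : Type*}

/-- The graph `G` with the edge `u v` added. -/
def addEdge (G : SimpleGraph V) (u v : V) : SimpleGraph V :=
  G ⊔ SimpleGraph.fromEdgeSet {s(u, v)}

/-- `G` is `K_s`-saturated: `G` is `K_s`-free and adding any missing edge creates a `K_s`. -/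
def KSat (s : ℕ) (G : SimpleGraph V) : Prop :=
  G.CliqueFree s ∧ ∀ u v : V, u ≠ v → ¬ G.Adj u v → ¬ (addEdge G u v).CliqueFree s

/-- The number of copies of `K_r` in `G`: the number of `r`-sets of vertices inducing
a complete graph. -/
noncomputable def cliqueCount (G : SimpleGraph V) (r : ℕ) : ℕ :=
  {t : Finset V | G.IsNClique r t}.ncard

/-- `sat(n, K_r, K_s)`: minimum number of copies of `K_r` in an `n`-vertex
`K_s`-saturated graph. -/
noncomputable def satCliques (n r s : ℕ) : ℕ :=
  sInf {m | ∃ G : SimpleGraph (Fin n), KSat s G ∧ cliqueCount G r = m}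

/-- The join `K_{s-2} ∗ ∅_{n-s+2}` on `Fin n`. -/
def joinGraph (n s : ℕ) : SimpleGraph (Fin n) :=
  SimpleGraph.fromRel (fun i _ => (i : ℕ) < s - 2)

/-- The number of copies of `C_r` in `G` : the number of subgraphs of `G`
isomorphic to the cycle on `r` vertices. -/
noncomputable def cycleCount (G : SimpleGraph V) (r : ℕ) : ℕ :=
  {H : G.Subgraph | Nonempty (H.coe ≃g cycleGraph r)}.ncard

/-- `sat(n, C_r, K_s)`. -/
noncomputable def satCyclesCliqueSat (n r s : ℕ) : ℕ :=
  sInf {m | ∃ G : SimpleGraph (Fin n), KSat s G ∧ cycleCount G r = m}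

/-- `G` contains a copy of `F`, i.e. a subgraph isomorphic to `F`. -/
def ContainsCopy {α β : Type*} (F : SimpleGraph α) (G : SimpleGraph β) : Prop :=
  ∃ f : α → β, Function.Injective f ∧ ∀ a b : α, F.Adj a b → G.Adj (f a) (f b)

/-- strongly K_s-saturated -/
def StronglyKSat (s : ℕ) (G : SimpleGraph V) : Prop :=
  ∀ u v : V, u ≠ v → ¬ G.Adj u v →
    ∃ t : Finset V, (addEdge G u v).IsNClique s t ∧ u ∈ t ∧ v ∈ t

/-- dumbbell -/
def dumbbell (m : ℕ) : SimpleGraph (Fin (2 * m)) :=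
  SimpleGraph.fromRel (fun i j =>
    ((i : ℕ) < m ∧ (j : ℕ) < m) ∨ (m ≤ (i : ℕ) ∧ m ≤ (j : ℕ)) ∨ ((i : ℕ) = 0 ∧ (j : ℕ) = m))

def Vgraph (m : ℕ) : SimpleGraph (Fin (m + 2)) :=
  SimpleGraph.fromRel (fun i j =>
    ((i : ℕ) < m ∧ (j : ℕ) < m) ∨ ((i : ℕ) = 0 ∧ m ≤ (j : ℕ)))

def lambdaGraph (m : ℕ) : SimpleGraph (Fin (m + 1)) :=
  SimpleGraph.fromRel (fun i j =>
    ((i : ℕ) < m ∧ (j : ℕ) < m) ∨ ((i : ℕ) = m ∧ (j : ℕ) < 2))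

def VgraphGen (m r : ℕ) : SimpleGraph (Fin (m + (m - r))) :=
  SimpleGraph.fromRel (fun i j =>
    ((i : ℕ) < m ∧ (j : ℕ) < m) ∨
      (((i : ℕ) = 0 ∨ m ≤ (i : ℕ)) ∧ ((j : ℕ) = 0 ∨ m ≤ (j : ℕ))))

def lambdaGraphGen (m r : ℕ) : SimpleGraph (Fin (m + 1)) :=
  SimpleGraph.fromRel (fun i j =>
    ((i : ℕ) < m ∧ (j : ℕ) < m) ∨ ((i : ℕ) = m ∧ (j : ℕ) < r))

/-- `G` is saturated with respect to the family `{F₁, F₂, F₃}`. -/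
def FamSat3 {α₁ α₂ α₃ : Type*} (F₁ : SimpleGraph α₁) (F₂ : SimpleGraph α₂)
    (F₃ : SimpleGraph α₃) (G : SimpleGraph V) : Prop :=
  ¬ ContainsCopy F₁ G ∧ ¬ ContainsCopy F₂ G ∧ ¬ ContainsCopy F₃ G ∧
    ∀ u v : V, u ≠ v → ¬ G.Adj u v →
      ContainsCopy F₁ (addEdge G u v) ∨ ContainsCopy F₂ (addEdge G u v) ∨
        ContainsCopy F₃ (addEdge G u v)

noncomputable def satFam3 {α₁ α₂ α₃ : Type*} (n : ℕ) (F₁ : SimpleGraph α₁)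
    (F₂ : SimpleGraph α₂) (F₃ : SimpleGraph α₃) : ℕ :=
  sInf {m | ∃ G : SimpleGraph (Fin n), FamSat3 F₁ F₂ F₃ G ∧ G.edgeSet.ncard = m}

noncomputable def satCliquesFam3 {α₁ α₂ α₃ : Type*} (n r : ℕ) (F₁ : SimpleGraph α₁)
    (F₂ : SimpleGraph α₂) (F₃ : SimpleGraph α₃) : ℕ :=
  sInf {m | ∃ G : SimpleGraph (Fin n), FamSat3 F₁ F₂ F₃ G ∧ cliqueCount G r = m}

/-- saturation w.r.t. a single graph, with copies as subgraphs. -/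
def SatGraph {α : Type*} (F : SimpleGraph α) (G : SimpleGraph V) : Prop :=
  ¬ ContainsCopy F G ∧ ∀ u v : V, u ≠ v → ¬ G.Adj u v → ContainsCopy F (addEdge G u v)

noncomputable def satCyclesGraphSat {α : Type*} (n r : ℕ) (F : SimpleGraph α) : ℕ :=
  sInf {m | ∃ G : SimpleGraph (Fin n), SatGraph F G ∧ cycleCount G r = m}

/-- number of independent sets of size l -/
noncomputable def indepCount (G : SimpleGraph V) (l : ℕ) : ℕ :=
  {t : Finset V | t.card = l ∧ ∀ a ∈ t, ∀ b ∈ t, ¬ G.Adj a b}.ncard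

/-- Ramsey number -/
noncomputable def ramsey (l s : ℕ) : ℕ :=
  sInf {N | ∀ G : SimpleGraph (Fin N),
    (∃ t : Finset (Fin N), t.card = l ∧ ∀ a ∈ t, ∀ b ∈ t, ¬ G.Adj a b) ∨
      ∃ t : Finset (Fin N), G.IsNClique s t}

open scoped Classical in
/-- The `p`-cliques of `G` all of whose vertices are adjacent to `a`. -/
noncomputable def linkCliques [Fintype V] (G : SimpleGraph V) (p : ℕ) (a : V) :
    Finset (Finset V) :=
  {T | G.IsNClique p T ∧ ∀ z ∈ T, G.Adj a z}

theorem mem_linkCliques [Fintype V] {G : SimpleGraph V} {p : ℕ} {a : V} {T : Finset V} :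
    T ∈ linkCliques G p a ↔ G.IsNClique p T ∧ ∀ z ∈ T, G.Adj a z := by
  simp [linkCliques]

open scoped Classical in
/-- The vertices `a` such that more than `D` copies of `K_p` lie in the neighbourhood of `a`. -/
noncomputable def heavyVertices [Fintype V] (G : SimpleGraph V) (p D : ℕ) : Finset V :=
  {a | D < #(linkCliques G p a)}

theorem mem_heavyVertices [Fintype V] {G : SimpleGraph V} {p D : ℕ} {a : V} :
    a ∈ heavyVertices G p D ↔ D < #(linkCliques G p a) := by
  simp [heavyVertices]

open scoped Classical in
/-- The vertices adjacent to every vertex of `Q`. -/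
noncomputable def jointNbrs [Fintype V] (G : SimpleGraph V) (Q : Finset V) : Finset V :=
  {a | ∀ q ∈ Q, G.Adj a q}

theorem mem_jointNbrs [Fintype V] {G : SimpleGraph V} {Q : Finset V} {a : V} :
    a ∈ jointNbrs G Q ↔ ∀ q ∈ Q, G.Adj a q := by
  simp [jointNbrs]

theorem cliqueCount_eq_card [Fintype V] [DecidableEq V] (G : SimpleGraph V)
    [DecidableRel G.Adj] (r : ℕ) :
    cliqueCount G r = #(G.cliqueFinset r) := by
  rw [cliqueCount, ← Set.ncard_coe_finset]
  congr 1
  ext t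
  simp

theorem addEdge_adj {G : SimpleGraph V} {u v a b : V} :
    (addEdge G u v).Adj a b ↔ G.Adj a b ∨ (s(u, v) = s(a, b) ∧ a ≠ b) := by
  simp only [addEdge, sup_adj, fromEdgeSet_adj, Set.mem_singleton_iff]
  tauto

/-- In a `K_{k+2}`-saturated graph, any two nonadjacent vertices have a `K_k` in their
common neighbourhood. -/
theorem KSat.exists_isNClique {k : ℕ} {G : SimpleGraph V} (hG : KSat (k + 2) G) {u v : V}
    (huv : u ≠ v) (h : ¬ G.Adj u v) :
    ∃ K : Finset V, G.IsNClique k K ∧ ∀ z ∈ K, G.Adj u z ∧ G.Adj v z := by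
  classical
  obtain ⟨hfree, hsat⟩ := hG
  have h1 := hsat u v huv h
  simp only [CliqueFree, not_forall, not_not] at h1
  obtain ⟨t, ht, htc⟩ := h1
  have key : ∀ a ∈ t, ∀ b ∈ t, a ≠ b → s(u, v) ≠ s(a, b) → G.Adj a b := by
    intro a ha b hb hab hne
    rcases addEdge_adj.1 (ht ha hb hab) with h2 | h2
    · exact h2
    · exact absurd h2.1 hne
  have hut : u ∈ t := by
    by_contra hu
    refine hfree t ⟨fun a ha b hb hab ↦ key a ha b hb hab fun he ↦ ?_, htc⟩
    rcases Sym2.eq_iff.1 he with ⟨rfl, _⟩ | ⟨rfl, _⟩ <;> exact hu (by assumption)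
  have hvt : v ∈ t := by
    by_contra hv
    refine hfree t ⟨fun a ha b hb hab ↦ key a ha b hb hab fun he ↦ ?_, htc⟩
    rcases Sym2.eq_iff.1 he with ⟨_, rfl⟩ | ⟨_, rfl⟩ <;> exact hv (by assumption)
  refine ⟨(t.erase u).erase v, ⟨?_, ?_⟩, ?_⟩
  · intro a ha b hb hab
    simp only [coe_erase, Set.mem_sdiff, Set.mem_singleton_iff, mem_coe] at ha hb
    refine key a ha.1.1 b hb.1.1 hab fun he ↦ ?_
    rcases Sym2.eq_iff.1 he with ⟨rfl, _⟩ | ⟨_, rfl⟩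
    · exact ha.1.2 rfl
    · exact ha.2 rfl
  · rw [card_erase_of_mem (mem_erase.2 ⟨huv.symm, hvt⟩), card_erase_of_mem hut, htc]
    rfl
  · intro z hz
    simp only [mem_erase] at hz
    obtain ⟨hzv, hzu, hzt⟩ := hz
    constructor
    · refine key u hut z hzt hzu.symm fun he ↦ ?_
      rcases Sym2.eq_iff.1 he with ⟨_, h2⟩ | ⟨h2, _⟩
      · exact hzv h2.symm
      · exact hzu h2.symm
    · refine key v hvt z hzt hzv.symm fun he ↦ ?_
      rcases Sym2.eq_iff.1 he with ⟨h2, _⟩ | ⟨h2, _⟩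
      · exact huv h2
      · exact hzu h2.symm

/-- The common neighbourhood of a `K_k` in a `K_{k+2}`-free graph is independent. -/
theorem not_adj_of_common_nbr {k : ℕ} {G : SimpleGraph V} (hG : G.CliqueFree (k + 2))
    {Q : Finset V} (hQ : G.IsNClique k Q) {x y : V} (hx : ∀ q ∈ Q, G.Adj x q)
    (hy : ∀ q ∈ Q, G.Adj y q) : ¬ G.Adj x y := by
  classical
  intro hxy
  have h1 := hQ.insert hy
  refine hG _ (h1.insert (a := x) fun b hb ↦ ?_)
  rcases mem_insert.1 hb with rfl | hb
  · exact hxy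
  · exact hx b hb

/-- If some vertex lies outside a clique `Q ≅ K_k` and its common neighbourhood `S`, then each
`x ∈ S` has in its neighbourhood a `K_p` that avoids `S` and is not contained in `Q`. -/
theorem exists_extra_clique {k p : ℕ} (hp : 1 ≤ p) (hpk : p ≤ k) {G : SimpleGraph V}
    (hG : KSat (k + 2) G) {Q : Finset V} (hQ : G.IsNClique k Q) {w : V} (hwQ : w ∉ Q)
    (hwS : ¬ ∀ q ∈ Q, G.Adj w q) {x : V} (hx : ∀ q ∈ Q, G.Adj x q) :
    ∃ T : Finset V, G.IsNClique p T ∧ (∀ z ∈ T, G.Adj x z) ∧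
      (∀ z ∈ T, ¬ ∀ q ∈ Q, G.Adj z q) ∧ ¬ T ⊆ Q := by
  classical
  suffices h : ∃ K : Finset V, G.IsClique (K : Set V) ∧ p ≤ #K ∧ (∀ z ∈ K, G.Adj x z) ∧
      (∀ z ∈ K, ¬ ∀ q ∈ Q, G.Adj z q) ∧ ∃ z ∈ K, z ∉ Q by
    obtain ⟨K, hK, hc, hKx, hKS, z, hz, hzQ⟩ := h
    obtain ⟨T, hzT, hTK, hT⟩ := exists_subsuperset_card_eq
      (singleton_subset_iff.2 hz) (by simpa using hp) hc
    exact ⟨T, ⟨hK.subset (coe_subset.2 hTK), hT⟩, fun y hy ↦ hKx y (hTK hy),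
      fun y hy ↦ hKS y (hTK hy), fun hTQ ↦ hzQ (hTQ (singleton_subset_iff.1 hzT))⟩
  have hSQ : ∀ z ∈ Q, ¬ ∀ q ∈ Q, G.Adj z q := fun z hz hzq ↦ G.loopless.irrefl z (hzq z hz)
  by_cases hall : ∀ y, y ∉ Q → (¬ ∀ q ∈ Q, G.Adj y q) → G.Adj x y
  · obtain ⟨q, hq, hwq⟩ : ∃ q ∈ Q, ¬ G.Adj w q := by simpa using hwS
    obtain ⟨K, hK, hKz⟩ := hG.exists_isNClique (ne_of_mem_of_not_mem hq hwQ).symm hwq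
    have hnot : ∀ z ∈ insert w (K.filter fun z ↦ ¬ ∀ q ∈ Q, G.Adj z q),
        ¬ ∀ q ∈ Q, G.Adj z q := by
      intro z hz
      rcases mem_insert.1 hz with rfl | hz
      · exact hwS
      · exact (mem_filter.1 hz).2
    refine ⟨insert w (K.filter fun z ↦ ¬ ∀ q ∈ Q, G.Adj z q), ?_, ?_, ?_, hnot, w,
      mem_insert_self _ _, hwQ⟩
    · rw [coe_insert]
      refine (hK.isClique.subset (coe_subset.2 (filter_subset _ _))).insert fun b hb _ ↦ ?_
      exact (hKz b (mem_filter.1 hb).1).1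
    · rw [card_insert_of_notMem fun h ↦
        G.loopless.irrefl w (hKz w (mem_filter.1 h).1).1]
      have h1 : #(K.filter fun z ↦ ∀ q ∈ Q, G.Adj z q) ≤ 1 := by
        refine card_le_one.2 fun a ha b hb ↦ ?_
        rw [mem_filter] at ha hb
        by_contra hab
        exact not_adj_of_common_nbr hG.1 hQ ha.2 hb.2 (hK.isClique ha.1 hb.1 hab)
      have h2 := card_filter_add_card_filter_not (s := K) (fun z ↦ ∀ q ∈ Q, G.Adj z q)
      have h3 := hK.card_eq
      omega
    · intro z hz
      by_cases hzQ : z ∈ Q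
      · exact hx z hzQ
      · exact hall z hzQ (hnot z hz)
  · push Not at hall
    obtain ⟨y, hyQ, ⟨q, hq, hyq⟩, hxy⟩ := hall
    have hne : x ≠ y := by
      rintro rfl
      exact hyq (hx q hq)
    obtain ⟨K, hK, hKz⟩ := hG.exists_isNClique hne hxy
    refine ⟨K, hK.isClique, hK.card_eq ▸ hpk, fun z hz ↦ (hKz z hz).1, fun z hz hzS ↦
      not_adj_of_common_nbr hG.1 hQ hx hzS (hKz z hz).1, ?_⟩
    by_contra hcon
    push Not at hcon
    have hKQ : K = Q := eq_of_subset_of_card_le hcon (by rw [hK.card_eq, hQ.card_eq])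
    exact hyq (hKz q (hKQ ▸ hq)).2

section Finite

variable [Fintype V]

theorem sum_card_linkCliques_le (G : SimpleGraph V) (p : ℕ) :
    ∑ a, #(linkCliques G p a) ≤ (p + 1) * cliqueCount G (p + 1) := by
  classical
  rw [cliqueCount_eq_card]
  have h1 : ∀ a : V, #(linkCliques G p a) ≤ #{c ∈ G.cliqueFinset (p + 1) | a ∈ c} := by
    intro a
    refine card_le_card_of_injOn (insert a) ?_ ?_
    · intro T hT
      rw [mem_coe, mem_linkCliques] at hT
      rw [mem_coe, mem_filter, mem_cliqueFinset_iff]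
      exact ⟨hT.1.insert hT.2, mem_insert_self _ _⟩
    · intro T hT T' hT' h
      rw [mem_coe, mem_linkCliques] at hT hT'
      have ha : a ∉ T := fun h ↦ G.loopless.irrefl a (hT.2 a h)
      have ha' : a ∉ T' := fun h ↦ G.loopless.irrefl a (hT'.2 a h)
      rw [← erase_insert ha, ← erase_insert ha', h]
  refine (sum_le_sum fun a _ ↦ h1 a).trans ?_
  have h2 := sum_card_bipartiteAbove_eq_sum_card_bipartiteBelow
    (s := (univ : Finset V)) (t := G.cliqueFinset (p + 1)) (fun a c ↦ a ∈ c)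
  simp only [bipartiteAbove, bipartiteBelow] at h2
  rw [h2, mul_comm]
  refine (sum_le_card_nsmul _ _ (p + 1) fun c hc ↦ ?_)
  rw [mem_cliqueFinset_iff] at hc
  rw [filter_univ_mem, hc.card_eq]

theorem card_heavyVertices_mul_le (G : SimpleGraph V) (p D : ℕ) :
    #(heavyVertices G p D) * D ≤ (p + 1) * cliqueCount G (p + 1) := by
  refine le_trans ?_ (sum_card_linkCliques_le G p)
  rw [← smul_eq_mul]
  refine (card_nsmul_le_sum _ (fun a ↦ #(linkCliques G p a)) D fun a ha ↦ ?_).trans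
    (sum_le_sum_of_subset (subset_univ _))
  exact (mem_heavyVertices.1 ha).le

/-- The vertices lying in few copies of `K_{p+1}` are, up to a bounded set `U`, all joined to
some `K_k` inside `U`. -/
theorem exists_bounded_core {k p : ℕ} (hp : 1 ≤ p) (hpk : p ≤ k) {G : SimpleGraph V}
    (hG : KSat (k + 2) G) (D : ℕ) :
    ∃ U : Finset V, #U ≤ (k + 2) * (1 + D * p) ∧
      ∀ a, a ∉ heavyVertices G p D → a ∉ U →
        ∃ Q ⊆ U, G.IsNClique k Q ∧ ∀ q ∈ Q, G.Adj a q := by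
  classical
  obtain ⟨L, hL, hmax⟩ := exists_max_image
    ({L | G.IsClique (L : Set V) ∧ ∀ v ∈ L, #(linkCliques G p v) ≤ D} : Finset (Finset V))
    card ⟨∅, by simp⟩
  simp only [mem_filter, mem_univ, true_and] at hL hmax
  obtain ⟨hLc, hLD⟩ := hL
  have hLcard : #L ≤ k + 2 := by
    by_contra! h
    obtain ⟨t, ht, htc⟩ := exists_subset_card_eq h.le
    exact hG.1 t ⟨hLc.subset (coe_subset.2 ht), htc⟩
  refine ⟨L.biUnion fun v ↦ insert v ((linkCliques G p v).biUnion id), ?_, ?_⟩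
  · refine (card_biUnion_le_card_mul _ _ (1 + D * p) fun v hv ↦ ?_).trans
      (Nat.mul_le_mul_right _ hLcard)
    refine (card_insert_le _ _).trans ?_
    rw [add_comm]
    refine Nat.add_le_add_left ?_ 1
    refine (card_biUnion_le_card_mul _ _ p fun T hT ↦ ?_).trans
      (Nat.mul_le_mul_right _ (hLD v hv))
    exact (mem_linkCliques.1 hT).1.card_eq.le
  · intro a ha haU
    rw [mem_heavyVertices, not_lt] at ha
    have haL : a ∉ L := fun h ↦ haU (mem_biUnion.2 ⟨a, h, mem_insert_self _ _⟩)
    obtain ⟨v, hv, hav⟩ : ∃ v ∈ L, ¬ G.Adj a v := by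
      by_contra! hcon
      have h1 := hmax (insert a L) ⟨by
        rw [coe_insert]
        exact hLc.insert fun b hb _ ↦ hcon b hb, by simpa [ha] using hLD⟩
      rw [card_insert_of_notMem haL] at h1
      omega
    obtain ⟨K, hK, hKz⟩ := hG.exists_isNClique (ne_of_mem_of_not_mem hv haL).symm hav
    refine ⟨K, fun z hz ↦ ?_, hK, fun q hq ↦ (hKz q hq).1⟩
    obtain ⟨T, hzT, hTK, hT⟩ := exists_subsuperset_card_eq
      (singleton_subset_iff.2 hz) (by simpa using hp) (hK.card_eq ▸ hpk)
    refine mem_biUnion.2 ⟨v, hv, mem_insert_of_mem (mem_biUnion.2 ⟨T, ?_,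
      singleton_subset_iff.1 hzT⟩)⟩
    exact mem_linkCliques.2 ⟨⟨hK.isClique.subset (coe_subset.2 hTK), hT⟩,
      fun y hy ↦ (hKz y (hTK hy)).2⟩

open scoped Classical in
theorem le_cliqueCount_of_join {k p : ℕ} {G : SimpleGraph V} {Q : Finset V}
    (hQ : G.IsNClique k Q) (h : ∀ w, w ∉ Q → ∀ q ∈ Q, G.Adj w q) :
    (Fintype.card V - k) * k.choose p + k.choose (p + 1) ≤ cliqueCount G (p + 1) := by
  rw [cliqueCount_eq_card]
  have hdisj : Disjoint (Qᶜ.biUnion fun x ↦ (powersetCard p Q).image (insert x))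
      (powersetCard (p + 1) Q) := by
    rw [Finset.disjoint_left]
    intro c hc hc'
    simp only [mem_biUnion, mem_compl, mem_image, mem_powersetCard] at hc hc'
    obtain ⟨x, hx, T, -, rfl⟩ := hc
    exact hx (hc'.1 (mem_insert_self _ _))
  have hcard : #(Qᶜ.biUnion fun x ↦ (powersetCard p Q).image (insert x)) =
      (Fintype.card V - k) * k.choose p := by
    rw [card_biUnion, sum_const_nat (m := k.choose p), card_compl, hQ.card_eq]
    · intro x hx
      rw [mem_compl] at hx
      rw [card_image_of_injOn, card_powersetCard, hQ.card_eq]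
      intro T hT T' hT' he
      simp only [mem_coe, mem_powersetCard] at hT hT'
      rw [← erase_insert (fun h ↦ hx (hT.1 h)), ← erase_insert (fun h ↦ hx (hT'.1 h)), he]
    · intro x hx y hy hxy
      rw [Function.onFun, Finset.disjoint_left]
      intro c hc hc'
      simp only [mem_image, mem_powersetCard] at hc hc'
      obtain ⟨T, hT, rfl⟩ := hc
      obtain ⟨T', hT', he⟩ := hc'
      have : x ∈ insert y T' := he ▸ mem_insert_self _ _
      rcases mem_insert.1 this with h | h
      · exact hxy h
      · exact (mem_compl.1 hx) (hT'.1 h)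
  rw [← hcard, ← hQ.card_eq, ← card_powersetCard, ← card_union_of_disjoint hdisj]
  refine card_le_card fun c hc ↦ ?_
  rw [mem_cliqueFinset_iff]
  rcases mem_union.1 hc with hc | hc
  · simp only [mem_biUnion, mem_compl, mem_image, mem_powersetCard] at hc
    obtain ⟨x, hx, T, hT, rfl⟩ := hc
    exact IsNClique.insert ⟨hQ.isClique.subset (coe_subset.2 hT.1), hT.2⟩
      fun b hb ↦ h x hx b (hT.1 hb)
  · rw [mem_powersetCard] at hc
    exact ⟨hQ.isClique.subset (coe_subset.2 hc.1), hc.2⟩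

/-- Counting copies of `K_{p+1}`: each vertex of `A` contributes those whose other vertices lie
in a fixed `K_k` inside `U`, and each common neighbour of `Q` contributes one more. -/
theorem card_mul_choose_add_card_le [DecidableEq V] {k p : ℕ} (hp : 1 ≤ p) (hpk : p ≤ k) {G : SimpleGraph V}
    (hG : KSat (k + 2) G) {Q : Finset V} (hQ : G.IsNClique k Q) {w : V} (hwQ : w ∉ Q)
    (hwS : ¬ ∀ q ∈ Q, G.Adj w q) {U A : Finset V} (hQU : Q ⊆ U) (hAU : Disjoint A U)
    (hA : ∀ a ∈ A, ∃ R ⊆ U, G.IsNClique k R ∧ ∀ q ∈ R, G.Adj a q) :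
    #A * k.choose p + #(A ∩ jointNbrs G Q) ≤ cliqueCount G (p + 1) := by
  classical
  have hext : ∀ x, ∃ T : Finset V, (∀ q ∈ Q, G.Adj x q) → G.IsNClique p T ∧
      (∀ z ∈ T, G.Adj x z) ∧ (∀ z ∈ T, ¬ ∀ q ∈ Q, G.Adj z q) ∧ ¬ T ⊆ Q := by
    intro x
    by_cases hx : ∀ q ∈ Q, G.Adj x q
    · obtain ⟨T, hT⟩ := exists_extra_clique hp hpk hG hQ hwQ hwS hx
      exact ⟨T, fun _ ↦ hT⟩
    · exact ⟨∅, fun h ↦ absurd h hx⟩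
  choose T hT using hext
  have hcore : ∀ a, ∃ R : Finset V, a ∈ A → R ⊆ U ∧ G.IsNClique k R ∧ (∀ q ∈ R, G.Adj a q) ∧
      ((∀ q ∈ Q, G.Adj a q) → R = Q) := by
    intro a
    by_cases ha : ∀ q ∈ Q, G.Adj a q
    · exact ⟨Q, fun _ ↦ ⟨hQU, hQ, ha, fun _ ↦ rfl⟩⟩
    · by_cases haA : a ∈ A
      · obtain ⟨R, h1, h2, h3⟩ := hA a haA
        exact ⟨R, fun _ ↦ ⟨h1, h2, h3, fun h ↦ absurd h ha⟩⟩
      · exact ⟨∅, fun h ↦ absurd h haA⟩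
  choose R hR using hcore
  set base : V → Finset (Finset V) := fun a ↦ (powersetCard p (R a)).image (insert a)
    with hbase
  set extra : V → Finset (Finset V) :=
    fun a ↦ if ∀ q ∈ Q, G.Adj a q then {insert a (T a)} else ∅ with hextra
  have hnU : ∀ a ∈ A, a ∉ U := fun a ha h ↦ Finset.disjoint_left.1 hAU ha h
  have mem_base : ∀ a ∈ A, ∀ c ∈ base a, ∃ t ⊆ R a, #t = p ∧ c = insert a t := by
    intro a _ c hc
    simp only [hbase, mem_image, mem_powersetCard] at hc
    obtain ⟨t, ht, rfl⟩ := hc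
    exact ⟨t, ht.1, ht.2, rfl⟩
  have mem_extra : ∀ a, ∀ c ∈ extra a, (∀ q ∈ Q, G.Adj a q) ∧ c = insert a (T a) := by
    intro a c hc
    by_cases ha : ∀ q ∈ Q, G.Adj a q
    · simp only [hextra, if_pos ha, mem_singleton] at hc
      exact ⟨ha, hc⟩
    · simp [hextra, if_neg ha] at hc
  have base_unique : ∀ a ∈ A, ∀ c ∈ base a, ∀ y ∈ c, y ∉ U → y = a := by
    intro a ha c hc y hy hyU
    obtain ⟨t, ht, -, rfl⟩ := mem_base a ha c hc
    rcases mem_insert.1 hy with h | h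
    · exact h
    · exact absurd ((hR a ha).1 (ht h)) hyU
  have mem_self : ∀ a ∈ A, ∀ c ∈ base a ∪ extra a, a ∈ c := by
    intro a ha c hc
    rcases mem_union.1 hc with hc | hc
    · obtain ⟨t, -, -, rfl⟩ := mem_base a ha c hc
      exact mem_insert_self _ _
    · rw [(mem_extra a c hc).2]
      exact mem_insert_self _ _
  have hinner : ∀ a ∈ A, Disjoint (base a) (extra a) := by
    intro a ha
    rw [Finset.disjoint_left]
    intro c hc hc'
    obtain ⟨t, ht, -, rfl⟩ := mem_base a ha c hc
    obtain ⟨haS, he⟩ := mem_extra a _ hc'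
    obtain ⟨-, hTx, -, hTQ⟩ := hT a haS
    refine hTQ fun z hz ↦ ?_
    have : z ∈ insert a t := he ▸ mem_insert_of_mem hz
    rcases mem_insert.1 this with rfl | h
    · exact absurd (hTx z hz) (G.loopless.irrefl z)
    · rw [← (hR a ha).2.2.2 haS]
      exact ht h
  have houter : ∀ a ∈ A, ∀ b ∈ A, a ≠ b →
      Disjoint (base a ∪ extra a) (base b ∪ extra b) := by
    intro a ha b hb hab
    rw [Finset.disjoint_left]
    intro c hc hc'
    have hac := mem_self a ha c hc
    have hbc := mem_self b hb c hc'
    rcases mem_union.1 hc with hc | hc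
    · exact hab (base_unique a ha c hc b hbc (hnU b hb)).symm
    · rcases mem_union.1 hc' with hc' | hc'
      · exact hab (base_unique b hb c hc' a hac (hnU a ha))
      · obtain ⟨haS, rfl⟩ := mem_extra a c hc
        obtain ⟨hbS, -⟩ := mem_extra b _ hc'
        rcases mem_insert.1 hbc with h | h
        · exact hab h.symm
        · exact (hT a haS).2.2.1 b h hbS
  have hcount : ∀ a ∈ A, #(base a ∪ extra a) =
      k.choose p + if ∀ q ∈ Q, G.Adj a q then 1 else 0 := by
    intro a ha
    rw [card_union_of_disjoint (hinner a ha)]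
    congr 1
    · rw [hbase, card_image_of_injOn, card_powersetCard, (hR a ha).2.1.card_eq]
      intro t ht t' ht' he
      simp only [mem_coe, mem_powersetCard] at ht ht'
      have haR : a ∉ R a := fun h ↦ hnU a ha ((hR a ha).1 h)
      rw [← erase_insert (fun h ↦ haR (ht.1 h)), ← erase_insert (fun h ↦ haR (ht'.1 h)), he]
    · simp only [hextra]
      split_ifs <;> simp
  have htotal : #A * k.choose p + #(A ∩ jointNbrs G Q) =
      #(A.biUnion fun a ↦ base a ∪ extra a) := by
    rw [card_biUnion houter, sum_congr rfl hcount, sum_add_distrib, sum_const, smul_eq_mul,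
      ← card_filter]
    congr 2
    ext a
    rw [mem_inter, mem_filter, mem_jointNbrs]
  rw [htotal, cliqueCount_eq_card]
  refine card_le_card fun c hc ↦ ?_
  rw [mem_cliqueFinset_iff]
  obtain ⟨a, ha, hc⟩ := mem_biUnion.1 hc
  rcases mem_union.1 hc with hc | hc
  · obtain ⟨t, ht, htc, rfl⟩ := mem_base a ha c hc
    obtain ⟨-, h1, h2, -⟩ := hR a ha
    exact IsNClique.insert ⟨h1.isClique.subset (coe_subset.2 ht), htc⟩ fun b hb ↦ h2 b (ht hb)
  · obtain ⟨haS, rfl⟩ := mem_extra a c hc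
    exact (hT a haS).1.insert (hT a haS).2.1

/-- If the copies of `K_{p+1}` are linearly many, some `K_k` has linearly many common
neighbours. -/
theorem exists_isNClique_large_common_nbrs {k p D M : ℕ} (hp : 1 ≤ p) (hpk : p ≤ k)
    {G : SimpleGraph V} (hG : KSat (k + 2) G) (hM : M = (k + 2) * (1 + D * p))
    (hbad : 2 * #(heavyVertices G p D) ≤ Fintype.card V)
    (hV : 2 * M < Fintype.card V) :
    ∃ Q : Finset V, G.IsNClique k Q ∧
      Fintype.card V ≤ 2 * (#(jointNbrs G Q) * 2 ^ M) + 2 * M := by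
  classical
  obtain ⟨U, hU, hcore⟩ := exists_bounded_core hp hpk hG D
  rw [← hM] at hU
  set 𝒬 : Finset (Finset V) := {Q ∈ U.powerset | G.IsNClique k Q} with h𝒬
  have h𝒬c : #𝒬 ≤ 2 ^ M := by
    refine (card_filter_le _ _).trans ?_
    rw [card_powerset]
    exact Nat.pow_le_pow_right (by norm_num) hU
  have hcover : (heavyVertices G p D)ᶜ \ U ⊆ 𝒬.biUnion (jointNbrs G) := by
    intro a ha
    rw [mem_sdiff, mem_compl] at ha
    obtain ⟨Q, hQU, hQ, hQa⟩ := hcore a ha.1 ha.2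
    exact mem_biUnion.2 ⟨Q, mem_filter.2 ⟨mem_powerset.2 hQU, hQ⟩, mem_jointNbrs.2 hQa⟩
  have h1 := card_add_card_compl (heavyVertices G p D)
  have h2 := le_card_sdiff U (heavyVertices G p D)ᶜ
  have h3 := card_le_card hcover
  have hne : 𝒬.Nonempty := by
    by_contra h
    rw [not_nonempty_iff_eq_empty.1 h, biUnion_empty, card_empty] at h3
    omega
  obtain ⟨Q, hQ, hmax⟩ := exists_max_image 𝒬
    (fun Q ↦ #(jointNbrs G Q)) hne
  refine ⟨Q, (mem_filter.1 hQ).2, ?_⟩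
  have h4 := (card_biUnion_le_card_mul 𝒬 _ _ hmax).trans (Nat.mul_le_mul_right _ h𝒬c)
  rw [mul_comm (2 ^ M)] at h4
  omega

end Finite

theorem exists_le_cliqueCount {k p : ℕ} (hp : 1 ≤ p) (hpk : p ≤ k) :
    ∃ n₀ : ℕ, ∀ n ≥ n₀, ∀ G : SimpleGraph (Fin n), KSat (k + 2) G →
      (n - k) * k.choose p + k.choose (p + 1) ≤ cliqueCount G (p + 1) := by
  obtain ⟨C, hC⟩ : ∃ C, C = k.choose p := ⟨_, rfl⟩
  obtain ⟨B, hB⟩ : ∃ B, B = k.choose (p + 1) := ⟨_, rfl⟩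
  have hCpos : 0 < C := hC ▸ Nat.choose_pos hpk
  obtain ⟨E, hE⟩ : ∃ E, E = (p + 1) * (C + B) := ⟨_, rfl⟩
  have hEpos : 0 < E := by rw [hE]; positivity
  obtain ⟨M, hM⟩ : ∃ M, M = (k + 2) * (1 + (2 * E) * p) := ⟨_, rfl⟩
  obtain ⟨N, hN⟩ : ∃ N, N = 2 ^ M := ⟨_, rfl⟩
  obtain ⟨D, hD⟩ : ∃ D, D = E * (C * (4 * N)) := ⟨_, rfl⟩
  obtain ⟨M', hM'⟩ : ∃ M', M' = (k + 2) * (1 + D * p) + k := ⟨_, rfl⟩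
  refine ⟨4 * N * ((C + 1) * M') + 4 * M + 4 * N * B + 2 * M + k + 1, fun n hn G hG ↦ ?_⟩
  rw [← hC, ← hB]
  by_contra! hlt
  have hlin : (p + 1) * cliqueCount G (p + 1) ≤ E * n := by
    rw [hE, mul_assoc]
    refine Nat.mul_le_mul_left _ (hlt.le.trans ?_)
    have h1 : (n - k) * C ≤ n * C := Nat.mul_le_mul_right _ (Nat.sub_le _ _)
    have h2 : B * 1 ≤ B * n := Nat.mul_le_mul_left _ (by omega)
    nlinarith
  have hbad : 2 * #(heavyVertices G p (2 * E)) ≤ Fintype.card (Fin n) := by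
    have h1 := (card_heavyVertices_mul_le G p (2 * E)).trans hlin
    rw [Fintype.card_fin]
    refine Nat.le_of_mul_le_mul_left ?_ hEpos
    linarith
  obtain ⟨Q, hQ, hS⟩ := exists_isNClique_large_common_nbrs hp hpk hG hM hbad
    (by rw [Fintype.card_fin]; omega)
  rw [Fintype.card_fin, ← hN] at hS
  by_cases hjoin : ∀ w, w ∉ Q → ∀ q ∈ Q, G.Adj w q
  · have h1 := le_cliqueCount_of_join (p := p) hQ hjoin
    rw [Fintype.card_fin, ← hC, ← hB] at h1
    omega
  · simp only [not_forall, exists_prop] at hjoin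
    obtain ⟨w, hwQ, q, hq, hwq⟩ := hjoin
    have hwS : ¬ ∀ q ∈ Q, G.Adj w q := fun h ↦ hwq (h q hq)
    obtain ⟨U, hU, hcore⟩ := exists_bounded_core hp hpk hG D
    have hbad' : C * (4 * N) * #(heavyVertices G p D) ≤ n := by
      have h1 := (card_heavyVertices_mul_le G p D).trans hlin
      refine Nat.le_of_mul_le_mul_left ?_ hEpos
      rw [hD] at h1 ⊢
      linarith
    obtain ⟨b, hb⟩ : ∃ b, b = #(heavyVertices G p D) := ⟨_, rfl⟩
    rw [← hb] at hbad'
    set S := jointNbrs G Q with hS_def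
    set A := ((heavyVertices G p D)ᶜ ∪ S) \ (U ∪ Q) with hA
    have hUQ : #(U ∪ Q) ≤ M' := by
      refine (card_union_le _ _).trans ?_
      rw [hQ.card_eq]
      omega
    have hcount := card_mul_choose_add_card_le hp hpk hG hQ hwQ hwS
      (U := U ∪ Q) (A := A) subset_union_right sdiff_disjoint (by
        intro a ha
        rw [hA, mem_sdiff, mem_union, mem_union, not_or, mem_compl, hS_def,
          mem_jointNbrs] at ha
        rcases ha.1 with h | h
        · obtain ⟨R, hR, h1⟩ := hcore a h ha.2.1
          exact ⟨R, hR.trans subset_union_left, h1⟩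
        · exact ⟨Q, subset_union_right, hQ, h⟩)
    rw [← hC, ← hS_def] at hcount
    have hA1 : n ≤ #A + b + M' := by
      have h1 := card_add_card_compl (heavyVertices G p D)
      rw [Fintype.card_fin, ← hb] at h1
      have h2 := le_card_sdiff (U ∪ Q) ((heavyVertices G p D)ᶜ ∪ S)
      rw [← hA] at h2
      have h3 := card_le_card (subset_union_left (s₁ := (heavyVertices G p D)ᶜ) (s₂ := S))
      omega
    have hA2 : #S ≤ #(A ∩ S) + M' := by
      have h1 : S \ (U ∪ Q) ⊆ A ∩ S := by
        intro a ha
        rw [mem_sdiff] at ha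
        exact mem_inter.2 ⟨mem_sdiff.2 ⟨mem_union_right _ ha.1, ha.2⟩, ha.1⟩
      have h2 := card_le_card h1
      have h3 := le_card_sdiff (U ∪ Q) S
      omega
    have h0 : (n - k) * C ≤ n * C := Nat.mul_le_mul_right _ (Nat.sub_le _ _)
    have h1 : n * C ≤ (#A + b + M') * C := Nat.mul_le_mul_right _ hA1
    have h2 : #S ≤ b * C + M' * C + M' + B := by linarith
    have h3 : #S * N ≤ (b * C + M' * C + M' + B) * N := Nat.mul_le_mul_right _ h2
    linarith

/-- The first `k` vertices, as a subset of `Fin n`. -/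
def initialVertices (n k : ℕ) : Finset (Fin n) := {i | (i : ℕ) < k}

theorem mem_initialVertices {n k : ℕ} {i : Fin n} : i ∈ initialVertices n k ↔ (i : ℕ) < k := by
  simp [initialVertices]

theorem card_initialVertices {n k : ℕ} (h : k ≤ n) : #(initialVertices n k) = k := by
  rw [initialVertices, Fin.card_filter_val_lt, min_eq_right h]

theorem joinGraph_adj {n k : ℕ} {i j : Fin n} :
    (joinGraph n (k + 2)).Adj i j ↔
      i ≠ j ∧ (i ∈ initialVertices n k ∨ j ∈ initialVertices n k) := by
  simp [joinGraph, mem_initialVertices]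

theorem card_sdiff_initialVertices_le_one {n k : ℕ} {t : Finset (Fin n)}
    (ht : (joinGraph n (k + 2)).IsClique (t : Set (Fin n))) :
    #(t \ initialVertices n k) ≤ 1 := by
  refine card_le_one.2 fun a ha b hb ↦ ?_
  rw [mem_sdiff] at ha hb
  by_contra hab
  have := (joinGraph_adj.1 (ht ha.1 hb.1 hab)).2
  tauto

theorem kSat_joinGraph {n k : ℕ} (h : k ≤ n) : KSat (k + 2) (joinGraph n (k + 2)) := by
  constructor
  · intro t ht
    have h1 := card_sdiff_initialVertices_le_one ht.isClique
    have h2 := le_card_sdiff (initialVertices n k) t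
    rw [ht.card_eq, card_initialVertices h] at h2
    omega
  · intro u v huv hadj hfree
    have hQ : ∀ {x y : Fin n}, x ≠ y → y ∈ initialVertices n k →
        (addEdge (joinGraph n (k + 2)) u v).Adj x y := fun hxy hy ↦
      addEdge_adj.2 (Or.inl (joinGraph_adj.2 ⟨hxy, Or.inr hy⟩))
    have hu : u ∉ initialVertices n k := fun hu ↦ hadj (joinGraph_adj.2 ⟨huv, Or.inl hu⟩)
    have hv : v ∉ initialVertices n k := fun hv ↦ hadj (joinGraph_adj.2 ⟨huv, Or.inr hv⟩)
    have h0 : (addEdge (joinGraph n (k + 2)) u v).IsNClique k (initialVertices n k) :=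
      ⟨fun a _ b hb hab ↦ hQ hab hb, card_initialVertices h⟩
    refine hfree _ ((h0.insert (a := v) fun b hb ↦ hQ (by rintro rfl; exact hv hb) hb).insert
      (a := u) fun b hb ↦ ?_)
    rcases mem_insert.1 hb with rfl | hb
    · exact addEdge_adj.2 (Or.inr ⟨rfl, huv⟩)
    · exact hQ (by rintro rfl; exact hu hb) hb

theorem cliqueCount_joinGraph_le {n k : ℕ} (h : k ≤ n) (p : ℕ) :
    cliqueCount (joinGraph n (k + 2)) (p + 1) ≤
      (n - k) * k.choose p + k.choose (p + 1) := by
  classical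
  rw [cliqueCount_eq_card]
  have hsub : (joinGraph n (k + 2)).cliqueFinset (p + 1) ⊆
      ((initialVertices n k)ᶜ.biUnion fun x ↦
        (powersetCard p (initialVertices n k)).image (insert x)) ∪
      powersetCard (p + 1) (initialVertices n k) := by
    intro c hc
    rw [mem_cliqueFinset_iff] at hc
    rw [mem_union]
    by_cases hcQ : c ⊆ initialVertices n k
    · exact Or.inr (mem_powersetCard.2 ⟨hcQ, hc.card_eq⟩)
    · left
      obtain ⟨x, hxc, hx⟩ := not_subset.1 hcQ
      refine mem_biUnion.2 ⟨x, mem_compl.2 hx, mem_image.2 ⟨c.erase x, ?_, insert_erase hxc⟩⟩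
      refine mem_powersetCard.2 ⟨fun y hy ↦ ?_, by rw [card_erase_of_mem hxc, hc.card_eq]; rfl⟩
      rw [mem_erase] at hy
      by_contra hyQ
      exact hy.1 (card_le_one.1 (card_sdiff_initialVertices_le_one hc.isClique) y
        (mem_sdiff.2 ⟨hy.2, hyQ⟩) x (mem_sdiff.2 ⟨hxc, hx⟩))
  refine (card_le_card hsub).trans ((card_union_le _ _).trans ?_)
  rw [card_powersetCard, card_initialVertices h]
  refine Nat.add_le_add_right ((card_biUnion_le_card_mul _ _ (k.choose p) fun x _ ↦ ?_).trans ?_) _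
  · refine card_image_le.trans ?_
    rw [card_powersetCard, card_initialVertices h]
  · rw [card_compl, Fintype.card_fin, card_initialVertices h]

/-- For all integers `s > r ≥ 2` there exists `n₀ = n₀(r,s)` such that for
every `n ≥ n₀`, `sat(n, K_r, K_s) = (n - s + 2)·C(s-2, r-1) + C(s-2, r)`. -/
theorem sat_cliques_eq (r s : ℕ) (hr : 2 ≤ r) (hrs : r < s) :
    ∃ n₀ : ℕ, ∀ n ≥ n₀,
      satCliques n r s = (n - s + 2) * (s - 2).choose (r - 1) + (s - 2).choose r := by
  obtain ⟨p, rfl⟩ : ∃ p, r = p + 1 := ⟨r - 1, by omega⟩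
  obtain ⟨k, rfl⟩ : ∃ k, s = k + 2 := ⟨s - 2, by omega⟩
  obtain ⟨n₀, hn₀⟩ := exists_le_cliqueCount (k := k) (p := p) (by omega) (by omega)
  refine ⟨n₀ + k + 2, fun n hn ↦ ?_⟩
  have hkn : k ≤ n := by omega
  rw [show n - (k + 2) + 2 = n - k by omega, Nat.add_sub_cancel, Nat.add_sub_cancel]
  have hmem : cliqueCount (joinGraph n (k + 2)) (p + 1) ∈
      {m | ∃ G : SimpleGraph (Fin n), KSat (k + 2) G ∧ cliqueCount G (p + 1) = m} :=
    ⟨_, kSat_joinGraph hkn, rfl⟩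
  refine le_antisymm ((Nat.sInf_le hmem).trans (cliqueCount_joinGraph_le hkn p))
    (le_csInf ⟨_, hmem⟩ ?_)
  rintro m ⟨G, hG, rfl⟩
  exact hn₀ n (by omega) G hG
end

section
/- For all integers s > r ≥ 2 there exist constants c = c(r,s) > 0 and n₀ = n₀(r,s) such that for every n ≥ n₀, any K_s-saturated graph on n vertices with at most sat(n, K_r, K_s) + c·n copies of K_r is isomorphic to the join K_{s-2} ∗ \bar{K}_{n-s+2} of a clique on s-2 vertices and an edgeless graph on n-s+2 vertices. -/
open SimpleGraph Finset

variable {V : Type*}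

theorem KSat.exists_isNClique_common {s : ℕ} {G : SimpleGraph V} (hG : KSat s G) {u v : V}
    (huv : u ≠ v) (h : ¬ G.Adj u v) :
    ∃ T : Finset V, G.IsNClique (s - 2) T ∧ ∀ t ∈ T, G.Adj u t ∧ G.Adj v t := by
  classical
  have hadj : ∀ a b, (addEdge G u v).Adj a b →
      G.Adj a b ∨ (a = u ∧ b = v) ∨ (a = v ∧ b = u) := by
    intro a b hab
    simp only [addEdge, sup_adj, fromEdgeSet_adj, Set.mem_singleton_iff, Sym2.eq_iff] at hab
    tauto
  have hS := hG.2 u v huv h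
  simp only [CliqueFree, not_forall, not_not] at hS
  obtain ⟨S, hS⟩ := hS
  have hmem : u ∈ S ∧ v ∈ S := by
    by_contra hcon
    refine hG.1 S ⟨fun a ha b hb hab => ?_, hS.card_eq⟩
    rcases hadj a b (hS.isClique ha hb hab) with h1 | ⟨rfl, rfl⟩ | ⟨rfl, rfl⟩
    · exact h1
    · exact absurd ⟨ha, hb⟩ hcon
    · exact absurd ⟨hb, ha⟩ hcon
  refine ⟨(S.erase u).erase v, ⟨fun a ha b hb hab => ?_, ?_⟩, fun t ht => ?_⟩
  · simp only [coe_erase, Set.mem_sdiff, mem_coe, Set.mem_singleton_iff] at ha hb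
    rcases hadj a b (hS.isClique ha.1.1 hb.1.1 hab) with h1 | h1 | h1
    · exact h1
    · exact absurd h1.1 ha.1.2
    · exact absurd h1.1 ha.2
  · rw [card_erase_of_mem (mem_erase.2 ⟨huv.symm, hmem.2⟩), card_erase_of_mem hmem.1, hS.card_eq]
    omega
  · simp only [mem_erase] at ht
    constructor
    · rcases hadj u t (hS.isClique hmem.1 ht.2.2 (Ne.symm ht.2.1)) with h1 | h1 | h1
      · exact h1
      · exact absurd h1.2 ht.1
      · exact absurd h1.1 huv
    · rcases hadj v t (hS.isClique hmem.2 ht.2.2 (Ne.symm ht.1)) with h1 | h1 | h1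
      · exact h1
      · exact absurd h1.1 huv.symm
      · exact absurd h1.2 ht.2.1

/-- In a clique with at least `r - 1` vertices, all adjacent to `x`, every vertex lies on a common
`r`-clique with `x`. -/
theorem exists_isNClique_insert {r : ℕ} (hr : 2 ≤ r) {G : SimpleGraph V} {T : Finset V} {x y : V}
    (hT : G.IsClique T) (hcard : r ≤ #T + 1) (hx : ∀ t ∈ T, G.Adj x t) (hy : y ∈ T) :
    ∃ S : Finset V, G.IsNClique r S ∧ x ∈ S ∧ y ∈ S := by
  classical
  obtain ⟨R, hyR, hRT, hR⟩ := exists_subsuperset_card_eq (s := {y}) (t := T) (n := r - 1)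
    (by simpa using hy) (by simp; omega) (by omega)
  have hRc : G.IsNClique (r - 1) R := ⟨hT.subset (by exact_mod_cast hRT), hR⟩
  have := hRc.insert (a := x) fun b hb => hx b (hRT hb)
  rw [Nat.sub_add_cancel (by omega)] at this
  exact ⟨_, this, mem_insert_self _ _, mem_insert_of_mem (hyR (mem_singleton_self y))⟩

/-- If some vertex `x` lies only on the `r`-cliques inside `Q ∪ {x}` for an `(s-2)`-clique `Q`,
then the saturated graph is the join of `Q` with an independent set. -/
theorem KSat.adj_iff_of_forall_subset {r s : ℕ} (hr : 2 ≤ r) (hrs : r < s) {G : SimpleGraph V}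
    [DecidableEq V] (hG : KSat s G) {x : V} {Q : Finset V} (hQ : G.IsNClique (s - 2) Q)
    (hxQ : ∀ q ∈ Q, G.Adj x q)
    (hx : ∀ S : Finset V, G.IsNClique r S → x ∈ S → S ⊆ insert x Q) (a b : V) :
    G.Adj a b ↔ a ≠ b ∧ (a ∈ Q ∨ b ∈ Q) := by
  classical
  have hxQ' : x ∉ Q := fun h => (hxQ x h).ne rfl
  have hindep : ∀ a b, (∀ q ∈ Q, G.Adj a q) → (∀ q ∈ Q, G.Adj b q) → ¬ G.Adj a b := by
    intro a b ha hb hab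
    have h1 := (hQ.insert hb).insert (a := a) (by
      intro c hc
      rcases mem_insert.1 hc with rfl | hc
      · exact hab
      · exact ha c hc)
    rw [show s - 2 + 1 + 1 = s by omega] at h1
    exact hG.1 _ h1
  have hadj : ∀ y, (∃ q ∈ Q, ¬ G.Adj y q) → G.Adj x y := by
    rintro y ⟨q, hq, hyq⟩
    by_contra hxy
    have hne : x ≠ y := by
      rintro rfl
      exact hyq (hxQ q hq)
    obtain ⟨T, hT, hTa⟩ := hG.exists_isNClique_common hne hxy
    have hTQ : T ⊆ Q := by
      intro t ht
      obtain ⟨S, hS, hxS, htS⟩ := exists_isNClique_insert hr hT.isClique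
        (by rw [hT.card_eq]; omega) (fun t ht => (hTa t ht).1) ht
      exact (mem_insert.1 (hx S hS hxS htS)).resolve_left (hTa t ht).1.ne'
    have := eq_of_subset_of_card_le hTQ (by rw [hT.card_eq, hQ.card_eq])
    exact hyq (hTa q (this ▸ hq)).2
  have hall : ∀ y, y ∉ Q → ∀ q ∈ Q, G.Adj y q := by
    intro y hy
    by_contra! hcon
    obtain ⟨q, hq, hyq⟩ := hcon
    obtain ⟨T, hT, hTa⟩ := hG.exists_isNClique_common (by rintro rfl; exact hy hq) hyq
    have hyT : G.IsNClique (s - 2 + 1) (insert y T) := hT.insert fun t ht => (hTa t ht).1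
    set I := (insert y T).filter (fun t => ∀ q ∈ Q, G.Adj t q) with hI
    have hI1 : #I ≤ 1 := by
      rw [card_le_one]
      intro a ha b hb
      by_contra hab
      rw [hI, mem_filter] at ha hb
      exact hindep a b ha.2 hb.2 (hyT.isClique ha.1 hb.1 hab)
    have hcard : #(insert y T \ I) + #I = #(insert y T) :=
      card_sdiff_add_card_eq_card (filter_subset _ _)
    have hyI : y ∈ insert y T \ I := by
      simp only [hI, mem_sdiff, mem_insert_self, mem_filter, true_and]
      exact fun h => hyq (h q hq)
    obtain ⟨S, hS, hxS, hyS⟩ := exists_isNClique_insert (T := insert y T \ I) (x := x) hr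
      (hyT.isClique.subset (coe_subset.2 sdiff_subset)) (by rw [hyT.card_eq] at hcard; omega) (by
        intro t ht
        rw [hI, mem_sdiff, mem_filter, not_and] at ht
        have h2 := ht.2 ht.1
        push Not at h2
        exact hadj t h2) hyI
    rcases mem_insert.1 (hx S hS hxS hyS) with rfl | h
    · exact hyq (hxQ q hq)
    · exact hy h
  constructor
  · intro hab
    refine ⟨hab.ne, ?_⟩
    by_contra! hcon
    exact hindep a b (hall a hcon.1) (hall b hcon.2) hab
  · rintro ⟨hne, h⟩
    by_cases ha : a ∈ Q
    · by_cases hb : b ∈ Q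
      · exact hQ.isClique ha hb hne
      · exact (hall b hb a ha).symm
    · exact hall a ha b (h.resolve_left ha)

theorem joinGraph_adj_s1 {n s : ℕ} {a b : Fin n} :
    (joinGraph n s).Adj a b ↔ a ≠ b ∧ ((a : ℕ) < s - 2 ∨ (b : ℕ) < s - 2) := by
  simp [joinGraph]

theorem card_filter_val_lt {n s : ℕ} (hn : s ≤ n) :
    #{i : Fin n | (i : ℕ) < s - 2} = s - 2 := by
  rw [Fin.card_filter_val_lt]
  omega

theorem nonempty_iso_joinGraph {n s : ℕ} (hn : s ≤ n) {G : SimpleGraph (Fin n)}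
    {Q : Finset (Fin n)} (hQ : #Q = s - 2)
    (h : ∀ a b, G.Adj a b ↔ a ≠ b ∧ (a ∈ Q ∨ b ∈ Q)) : Nonempty (G ≃g joinGraph n s) := by
  have hc : Fintype.card {i // i ∈ Q} = Fintype.card {i : Fin n // (i : ℕ) < s - 2} := by
    rw [Fintype.card_coe, hQ, Fintype.card_subtype, card_filter_val_lt hn]
  let e := Fintype.equivOfCardEq hc
  have he : ∀ a, (e.extendSubtype a : ℕ) < s - 2 ↔ a ∈ Q := fun a =>
    ⟨fun ha => by
      by_contra h
      exact e.extendSubtype_not_mem a h ha, fun ha => e.extendSubtype_mem a ha⟩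
  refine ⟨⟨e.extendSubtype, ?_⟩⟩
  intro a b
  rw [joinGraph_adj_s1, he, he, h, (e.extendSubtype.injective).ne_iff]

theorem kSat_joinGraph_s1 {n s : ℕ} (hs : 2 ≤ s) (hn : s ≤ n) : KSat s (joinGraph n s) := by
  set Z : Finset (Fin n) := {i : Fin n | (i : ℕ) < s - 2} with hZ
  have hZc : #Z = s - 2 := card_filter_val_lt hn
  constructor
  · intro S hS
    have h1 : #(S \ Z) ≤ 1 := by
      rw [card_le_one]
      intro a ha b hb
      by_contra hab
      simp only [hZ, mem_sdiff, mem_filter, mem_univ, true_and] at ha hb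
      have := (joinGraph_adj_s1.1 (hS.isClique ha.1 hb.1 hab)).2
      tauto
    have h2 := card_le_card_sdiff_add_card (s := S) (t := Z)
    rw [hS.card_eq] at h2
    omega
  · intro u v huv h
    rw [joinGraph_adj_s1] at h
    have hu : u ∉ Z := by simp only [hZ, mem_filter, mem_univ, true_and]; tauto
    have hv : v ∉ Z := by simp only [hZ, mem_filter, mem_univ, true_and]; tauto
    intro hfree
    refine hfree (insert u (insert v Z)) ⟨?_, ?_⟩
    · intro a ha b hb hab
      simp only [coe_insert, Set.mem_insert_iff, mem_coe, hZ, mem_filter, mem_univ,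
        true_and] at ha hb
      simp only [addEdge, sup_adj, fromEdgeSet_adj, Set.mem_singleton_iff, Sym2.eq_iff,
        joinGraph_adj_s1]
      grind
    · rw [card_insert_of_notMem (by simp [huv, hu]), card_insert_of_notMem hv, hZc]
      omega

theorem cliqueCount_joinGraph_le_s1 {n r s : ℕ} (hn : s ≤ n) :
    cliqueCount (joinGraph n s) r ≤ (s - 2).choose (r - 1) * n + 2 ^ (s - 2) := by
  classical
  set Z : Finset (Fin n) := {i : Fin n | (i : ℕ) < s - 2} with hZ
  have hZc : #Z = s - 2 := card_filter_val_lt hn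
  have hsub : (joinGraph n s).cliqueFinset r ⊆
      image₂ insert univ (powersetCard (r - 1) Z) ∪ Z.powerset := by
    intro t ht
    rw [mem_cliqueFinset_iff] at ht
    by_cases htZ : t ⊆ Z
    · exact mem_union_right _ (mem_powerset.2 htZ)
    obtain ⟨x, hxt, hxZ⟩ := not_subset.1 htZ
    refine mem_union_left _ (mem_image₂.2 ⟨x, mem_univ _, t.erase x, ?_, insert_erase hxt⟩)
    rw [mem_powersetCard, card_erase_of_mem hxt, ht.card_eq]
    refine ⟨fun y hy => ?_, rfl⟩
    rw [mem_erase] at hy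
    have := (joinGraph_adj_s1.1 (ht.isClique hy.2 hxt hy.1)).2
    simp only [hZ, mem_filter, mem_univ, true_and] at hxZ ⊢
    tauto
  calc cliqueCount (joinGraph n s) r = #((joinGraph n s).cliqueFinset r) := cliqueCount_eq_card _ _
    _ ≤ _ := card_le_card hsub
    _ ≤ _ := card_union_le _ _
    _ ≤ _ := by
      refine add_le_add ((card_image₂_le _ _ _).trans ?_) ?_
      · rw [card_powersetCard, hZc, card_univ, Fintype.card_fin, mul_comm]
      · rw [card_powerset, hZc]

theorem satCliques_le {n r s : ℕ} (hs : 2 ≤ s) (hn : s ≤ n) :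
    satCliques n r s ≤ (s - 2).choose (r - 1) * n + 2 ^ (s - 2) :=
by
  have hmem : ∃ G : SimpleGraph (Fin n), KSat s G ∧
      cliqueCount G r = cliqueCount (joinGraph n s) r :=
    ⟨joinGraph n s, kSat_joinGraph_s1 hs hn, rfl⟩
  exact (Nat.sInf_le hmem).trans (cliqueCount_joinGraph_le_s1 hn)

/-- At most `r |F| / D` vertices lie in more than `D` members of a family `F` of
`r`-sets. -/
theorem card_filter_mem_mul_le [Fintype V] [DecidableEq V] {F : Finset (Finset V)} {r : ℕ}
    (hF : ∀ t ∈ F, #t = r) (D : ℕ) :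
    #{v : V | D < #{t ∈ F | v ∈ t}} * D ≤ #F * r := by
  refine card_mul_le_card_mul (fun v t => v ∈ t) (fun v hv => ?_) (fun t ht => ?_)
  · exact (mem_filter.1 hv).2.le
  · rw [← hF t ht]
    exact card_le_card fun v hv => ((mem_bipartiteBelow _).1 hv).2

/-- All vertices on at most `D` copies of `K_r` and outside a set `A` of bounded size
see an `(s-2)`-clique inside `A`. -/
theorem KSat.exists_core [Fintype V] [DecidableEq V] {r s : ℕ} (hr : 2 ≤ r) (hrs : r < s)
    {G : SimpleGraph V} [DecidableRel G.Adj] (hG : KSat s G) (D : ℕ) :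
    ∃ A : Finset V, #A ≤ r * (D * r + 1) ∧
      ∀ u ∉ A, #{t ∈ G.cliqueFinset r | u ∈ t} ≤ D →
        ∃ Q ⊆ A, G.IsNClique (s - 2) Q ∧ ∀ q ∈ Q, G.Adj u q := by
  classical
  let B : V → Finset V := fun v => insert v ({t ∈ G.cliqueFinset r | v ∈ t}.biUnion id)
  have hB : ∀ v t y, G.IsNClique r t → v ∈ t → y ∈ t → y ∈ B v := fun v t y ht hv hy =>
    mem_insert_of_mem (mem_biUnion.2
      ⟨t, mem_filter.2 ⟨mem_cliqueFinset_iff.2 ht, hv⟩, hy⟩)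
  let P : Finset V → Prop := fun K => G.IsClique K ∧
    (∀ v ∈ K, #{t ∈ G.cliqueFinset r | v ∈ t} ≤ D) ∧
    ∀ t, G.IsNClique r t → #(t ∩ K) ≤ 1
  obtain ⟨K, -, hK⟩ := (Set.toFinite {K : Finset V | P K}).exists_le_maximal (a := ∅)
    (by simp [P])
  obtain ⟨⟨hKc, hKD, hKr⟩, hmax⟩ := hK
  have hKcard : #K ≤ r := by
    by_contra! hlt
    obtain ⟨t, htK, ht⟩ := exists_subset_card_eq hlt.le
    have := hKr t ⟨hKc.subset (by exact_mod_cast htK), ht⟩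
    rw [inter_eq_left.2 htK] at this
    omega
  refine ⟨K.biUnion B, ?_, fun u hu huD => ?_⟩
  · refine (card_biUnion_le_card_mul _ _ (D * r + 1) fun v hv => ?_).trans
      (Nat.mul_le_mul_right _ hKcard)
    refine (card_insert_le _ _).trans (Nat.succ_le_succ ?_)
    refine (card_biUnion_le_card_mul _ _ r fun t ht => ?_).trans
      (Nat.mul_le_mul_right _ (hKD v hv))
    exact (mem_cliqueFinset_iff.1 (mem_filter.1 ht).1).card_eq.le
  · simp only [mem_biUnion, not_exists, not_and] at hu
    have huK : u ∉ K := fun h => hu u h (mem_insert_self _ _)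
    obtain ⟨k, hk, huk⟩ : ∃ k ∈ K, ¬ G.Adj u k := by
      by_contra! hcon
      refine huK (hmax (y := insert u K) ⟨?_, ?_, ?_⟩ (subset_insert _ _) (mem_insert_self _ _))
      · rw [coe_insert]
        exact hKc.insert fun b hb _ => hcon b hb
      · intro v hv
        rcases mem_insert.1 hv with rfl | hv
        · exact huD
        · exact hKD v hv
      · intro t ht
        by_cases hut : u ∈ t
        · rw [card_le_one]
          have key : ∀ a ∈ t ∩ insert u K, a = u := by
            intro a ha
            rw [mem_inter, mem_insert] at ha
            exact ha.2.resolve_right fun haK => hu a haK (hB a t u ht ha.1 hut)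
          intro a ha b hb
          rw [key a ha, key b hb]
        · rw [inter_insert_of_notMem hut]
          exact hKr t ht
    have hne : u ≠ k := by
      rintro rfl
      exact huK hk
    obtain ⟨Q, hQ, hQa⟩ := hG.exists_isNClique_common hne huk
    refine ⟨Q, fun q hq => ?_, hQ, fun q hq => (hQa q hq).1⟩
    obtain ⟨S, hS, hkS, hqS⟩ := exists_isNClique_insert hr hQ.isClique
      (by rw [hQ.card_eq]; omega) (fun t ht => (hQa t ht).2) hq
    exact mem_biUnion.2 ⟨k, hk, hB k S q hS hkS hqS⟩

/-- Vertices outside `A`, each seeing an `(s-2)`-clique inside `A` and lying on a further copy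
of `K_r`, force many copies of `K_r`. -/
theorem card_mul_le_card_cliqueFinset [Fintype V] [DecidableEq V] {r m : ℕ} (hr : 1 ≤ r)
    {G : SimpleGraph V} [DecidableRel G.Adj] {A W : Finset V} (hWA : Disjoint W A)
    {Q S : V → Finset V} (hQA : ∀ u ∈ W, Q u ⊆ A) (hQ : ∀ u ∈ W, G.IsNClique m (Q u))
    (hadj : ∀ u ∈ W, ∀ q ∈ Q u, G.Adj u q) (hS : ∀ u ∈ W, G.IsNClique r (S u))
    (hmem : ∀ u ∈ W, u ∈ S u) (hnot : ∀ u ∈ W, ¬ S u ⊆ insert u (Q u)) :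
    #W * (r * m.choose (r - 1) + 1) ≤ r * #(G.cliqueFinset r) := by
  have hnA : ∀ u ∈ W, u ∉ A := fun u hu => Finset.disjoint_left.1 hWA hu
  let I := W.sigma fun u => powersetCard (r - 1) (Q u)
  let f : (Σ _ : V, Finset V) → Finset V := fun p => insert p.1 p.2
  have hI : ∀ p ∈ I, p.1 ∈ W ∧ p.2 ⊆ Q p.1 ∧ #p.2 = r - 1 := fun p hp => by
    simpa [I, mem_sigma, mem_powersetCard] using hp
  have hfst : ∀ p ∈ I, ∀ u ∈ W, u ∈ f p → u = p.1 := by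
    intro p hp u hu huf
    obtain ⟨h1, h2, -⟩ := hI p hp
    exact (mem_insert.1 huf).resolve_right fun h => hnA u hu (hQA _ h1 (h2 h))
  have hinj : Set.InjOn f I := by
    intro p hp q hq hpq
    have h1 : p.1 = q.1 := hfst q hq p.1 (hI p hp).1 (hpq ▸ mem_insert_self _ _)
    obtain ⟨x, R⟩ := p
    obtain ⟨y, R'⟩ := q
    obtain rfl : x = y := h1
    have hnot : ∀ R, ⟨x, R⟩ ∈ I → x ∉ R := fun R hR h =>
      hnA x (hI _ hR).1 (hQA x (hI _ hR).1 ((hI _ hR).2.1 h))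
    have h2 : insert x R = insert x R' := hpq
    rw [← erase_insert (hnot R hp), h2, erase_insert (hnot R' hq)]
  have hcI : #(I.image f) = #W * m.choose (r - 1) := by
    rw [card_image_of_injOn hinj, card_sigma, sum_const_nat fun u hu => ?_]
    rw [card_powersetCard, (hQ u hu).card_eq]
  have hcS : #W ≤ r * #(W.image S) := by
    refine card_le_mul_card_image _ _ fun t ht => ?_
    obtain ⟨u, hu, rfl⟩ := mem_image.1 ht
    rw [← (hS u hu).card_eq]
    refine card_le_card fun v hv => ?_
    rw [mem_filter] at hv
    exact hv.2 ▸ hmem v hv.1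
  have hdis : Disjoint (I.image f) (W.image S) := by
    rw [Finset.disjoint_left]
    intro t h1 h2
    obtain ⟨p, hp, rfl⟩ := mem_image.1 h1
    obtain ⟨u, hu, hup⟩ := mem_image.1 h2
    obtain rfl := hfst p hp u hu (hup ▸ hmem u hu)
    exact hnot _ hu (hup ▸ insert_subset_insert _ (hI p hp).2.1)
  have hsub : I.image f ∪ W.image S ⊆ G.cliqueFinset r := by
    intro t ht
    rw [mem_cliqueFinset_iff]
    rcases mem_union.1 ht with h | h
    · obtain ⟨p, hp, rfl⟩ := mem_image.1 h
      obtain ⟨h1, h2, h3⟩ := hI p hp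
      have hR : G.IsNClique (r - 1) p.2 :=
        ⟨(hQ _ h1).isClique.subset (by exact_mod_cast h2), h3⟩
      have := hR.insert (a := p.1) fun b hb => hadj _ h1 b (h2 hb)
      rwa [Nat.sub_add_cancel hr] at this
    · obtain ⟨u, hu, rfl⟩ := mem_image.1 h
      exact hS u hu
  have := card_le_card hsub
  rw [card_union_of_disjoint hdis, hcI] at this
  nlinarith

/-- A saturated graph without a vertex whose copies of `K_r` all lie in one copy of `K_{s-1}`
has, up to bounded errors, many copies of `K_r`. -/
theorem KSat.card_mul_le [Fintype V] [DecidableEq V] {r s : ℕ} (hr : 2 ≤ r) (hrs : r < s)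
    {G : SimpleGraph V} [DecidableRel G.Adj] (hG : KSat s G)
    (hbad : ∀ x Q, G.IsNClique (s - 2) Q → (∀ q ∈ Q, G.Adj x q) →
      ∃ S : Finset V, G.IsNClique r S ∧ x ∈ S ∧ ¬ S ⊆ insert x Q) (D : ℕ) :
    ∃ h : ℕ, h * D ≤ #(G.cliqueFinset r) * r ∧
      Fintype.card V * (r * (s - 2).choose (r - 1) + 1) ≤ r * #(G.cliqueFinset r) +
        (h + r * (D * r + 1)) * (r * (s - 2).choose (r - 1) + 1) := by
  obtain ⟨A, hA, hcov⟩ := hG.exists_core hr hrs D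
  set H : Finset V := {v : V | D < #{t ∈ G.cliqueFinset r | v ∈ t}} with hH
  refine ⟨#H, card_filter_mem_mul_le
    (fun t ht => (mem_cliqueFinset_iff.1 ht).card_eq) D, ?_⟩
  set W := univ \ (H ∪ A) with hW
  have hWmem : ∀ u ∈ W, u ∉ A ∧ #{t ∈ G.cliqueFinset r | u ∈ t} ≤ D := by
    intro u hu
    simp only [hW, hH, mem_sdiff, mem_univ, mem_union, mem_filter, true_and, not_or,
      not_lt] at hu
    exact hu.symm
  have hex : ∀ u, ∃ Q S : Finset V, u ∈ W → Q ⊆ A ∧ G.IsNClique (s - 2) Q ∧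
      (∀ q ∈ Q, G.Adj u q) ∧ G.IsNClique r S ∧ u ∈ S ∧ ¬ S ⊆ insert u Q := by
    intro u
    by_cases hu : u ∈ W
    · obtain ⟨Q, hQA, hQ, huQ⟩ := hcov u (hWmem u hu).1 (hWmem u hu).2
      obtain ⟨S, hS⟩ := hbad u Q hQ huQ
      exact ⟨Q, S, fun _ => ⟨hQA, hQ, huQ, hS⟩⟩
    · exact ⟨∅, ∅, fun h => absurd h hu⟩
  choose Q S hQS using hex
  have hmain := card_mul_le_card_cliqueFinset (r := r) (m := s - 2) (G := G) (A := A) (W := W)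
    (Q := Q) (S := S) (by omega) (Finset.disjoint_left.2 fun u hu => (hWmem u hu).1)
    (fun u hu => (hQS u hu).1) (fun u hu => (hQS u hu).2.1) (fun u hu => (hQS u hu).2.2.1)
    (fun u hu => (hQS u hu).2.2.2.1) (fun u hu => (hQS u hu).2.2.2.2.1)
    (fun u hu => (hQS u hu).2.2.2.2.2)
  have hcard : Fintype.card V ≤ #W + (#H + #A) := by
    rw [← card_univ]
    exact (card_le_card_sdiff_add_card (t := H ∪ A)).trans
      (Nat.add_le_add_left (card_union_le _ _) _)
  calc _ ≤ (#W + (#H + r * (D * r + 1))) * (r * (s - 2).choose (r - 1) + 1) :=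
        Nat.mul_le_mul_right _ (by omega)
    _ ≤ _ := by rw [add_mul]; exact Nat.add_le_add_right hmain _

/-- For all integers `s > r ≥ 2` there exist `c > 0` and `n₀` such that for all
`n ≥ n₀`, any `K_s`-saturated graph on `n` vertices with at most `sat(n, K_r, K_s) + c·n` copies
of `K_r` is isomorphic to the join `K_{s-2} ∗ ∅_{n-s+2}`. -/
theorem sat_cliques_stability (r s : ℕ) (hr : 2 ≤ r) (hrs : r < s) :
    ∃ c : ℝ, 0 < c ∧ ∃ n₀ : ℕ, ∀ n ≥ n₀, ∀ G : SimpleGraph (Fin n),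
      KSat s G → (cliqueCount G r : ℝ) ≤ (satCliques n r s : ℝ) + c * n →
        Nonempty (G ≃g joinGraph n s) := by
  classical
  set M := (s - 2).choose (r - 1) with hM
  set P := r * M + 1 with hP
  set D := 4 * P ^ 2 with hD
  set a := r * (D * r + 1) with ha
  set E := r * 2 ^ (s - 2) with hE
  have hr0 : (0 : ℝ) < r := by exact_mod_cast (by omega : 0 < r)
  refine ⟨1 / (2 * r), by positivity, 5 * E + 4 * P * a + 1 + s, fun n hn G hG hcount => ?_⟩
  have hsn : s ≤ n := by omega
  by_cases hgood : ∃ x Q, G.IsNClique (s - 2) Q ∧ (∀ q ∈ Q, G.Adj x q) ∧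
      ∀ S : Finset (Fin n), G.IsNClique r S → x ∈ S → S ⊆ insert x Q
  · obtain ⟨x, Q, hQ, hxQ, hx⟩ := hgood
    exact nonempty_iso_joinGraph hsn hQ.card_eq
      (hG.adj_iff_of_forall_subset hr hrs hQ hxQ hx)
  exfalso
  push Not at hgood
  obtain ⟨h, h1, h2⟩ := hG.card_mul_le hr hrs hgood D
  rw [← cliqueCount_eq_card, Fintype.card_fin] at h2
  rw [← cliqueCount_eq_card] at h1
  rw [← hM, ← hP, ← ha] at h2
  set N := cliqueCount G r
  have h3 : 2 * (r * N) ≤ 2 * (r * M * n) + 2 * E + n := by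
    have hsat : (satCliques n r s : ℝ) ≤ M * n + 2 ^ (s - 2) := by
      exact_mod_cast satCliques_le (by omega) hsn
    have hN : (N : ℝ) ≤ M * n + 2 ^ (s - 2) + 1 / (2 * r) * n := by linarith
    have hN2 := mul_le_mul_of_nonneg_left hN (by positivity : (0 : ℝ) ≤ 2 * r)
    have : (2 * r : ℝ) * (M * n + 2 ^ (s - 2) + 1 / (2 * r) * n) =
        2 * (r * M * n) + 2 * (r * 2 ^ (s - 2)) + n := by field_simp
    rw [this] at hN2
    rw [hE]
    have h4 : (2 * (r * N) : ℝ) ≤ 2 * (r * M * n) + 2 * (r * 2 ^ (s - 2)) + n := by linarith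
    exact_mod_cast h4
  have hrM : r * M * n + n = P * n := by rw [hP]; ring
  have hP1 : 1 ≤ P := by omega
  have h4 : 4 * P * h ≤ n + E := by
    refine Nat.le_of_mul_le_mul_left (c := P) ?_ hP1
    have h5 : P * (4 * P * h) = h * D := by rw [hD]; ring
    have h6 : E ≤ P * E := Nat.le_mul_of_pos_left _ hP1
    rw [h5, mul_add]
    linarith [mul_comm N r]
  have h5 : (h + a) * P = P * h + P * a := by ring
  rw [h5, mul_comm n P] at h2
  linarith
end

section
/- Let s > r ≥ 2 be integers and n ≥ s. Let G be the n-vertex graph that is the join G₁ ∗ G₂, where G₁ is K_{s-1} minus an edge and G₂ is an edgeless graph on n - s + 1 vertices. Then G is K_s-saturated, and the number of copies of K_r in G equals (2·C(s-3, r-2) + C(s-3, r-1))·(n - s + 1) + 2·C(s-3, r-1) + C(s-3, r). -/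
open SimpleGraph Finset

variable {V : Type*}

/-- The `n`-vertex join of `K_{s-1}` minus an edge (the edge between vertices `0` and `1`)
with the edgeless graph on `n - s + 1` vertices. -/
def nearJoinGraph (n s : ℕ) : SimpleGraph (Fin n) :=
  SimpleGraph.fromRel (fun i j =>
    ((i : ℕ) < s - 1 ∧ (j : ℕ) < s - 1 ∧ ¬((i : ℕ) < 2 ∧ (j : ℕ) < 2)) ∨
      ((i : ℕ) < s - 1 ∧ s - 1 ≤ (j : ℕ)))

/-- Sets of size `k + 1` meeting `B` in at most one element either avoid `B`, or arise by adding
an element of `B` to a set of size `k`. -/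
theorem card_powersetCard_union_filter_inter_le_one {α : Type*} [DecidableEq α]
    {X B : Finset α} (hXB : Disjoint X B) (p : Finset α → Prop) [DecidablePred p] (k : ℕ) :
    #{t ∈ powersetCard (k + 1) (X ∪ B) | p (t ∩ X) ∧ #(t ∩ B) ≤ 1} =
      #{t ∈ powersetCard (k + 1) X | p t} + #B * #{t ∈ powersetCard k X | p t} := by
  have inter_X {t : Finset α} (h : t ⊆ X ∪ B) : t ∩ X = t \ B := by
    ext a
    have := @h a
    have := @Finset.disjoint_left.1 hXB a
    simp only [mem_inter, mem_sdiff, mem_union] at *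
    tauto
  rw [← card_product, ← card_filter_add_card_filter_not (fun t => t ∩ B = ∅)]
  congr 1
  · congr 1
    ext t
    simp only [mem_filter, mem_powersetCard]
    constructor
    · rintro ⟨⟨⟨ht, hc⟩, hp, -⟩, h0⟩
      have hd : Disjoint t B := disjoint_iff_inter_eq_empty.2 h0
      have htX : t ⊆ X := hd.left_le_of_le_sup_right ht
      exact ⟨⟨htX, hc⟩, by rwa [inter_eq_left.2 htX] at hp⟩
    · rintro ⟨⟨ht, hc⟩, hp⟩
      have h0 : t ∩ B = ∅ := disjoint_iff_inter_eq_empty.1 (hXB.mono_left ht)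
      exact ⟨⟨⟨ht.trans subset_union_left, hc⟩, by rwa [inter_eq_left.2 ht], by simp [h0]⟩, h0⟩
  · symm
    have notMem {b : α} {t : Finset α} (hb : b ∈ B) (ht : t ⊆ X) : b ∉ t :=
      fun h => Finset.disjoint_left.1 hXB (ht h) hb
    have insert_inter_B {b : α} {t : Finset α} (hb : b ∈ B) (ht : t ⊆ X) :
        insert b t ∩ B = {b} := by
      rw [insert_inter_of_mem hb, disjoint_iff_inter_eq_empty.1 (hXB.mono_left ht)]
      simp
    have insert_inter_X {b : α} {t : Finset α} (hb : b ∈ B) (ht : t ⊆ X) :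
        insert b t ∩ X = t := by
      rw [insert_inter_of_notMem (Finset.disjoint_right.1 hXB hb), inter_eq_left.2 ht]
    refine card_bij (fun x _ => insert x.1 x.2) ?_ ?_ ?_
    · rintro ⟨b, t⟩ h
      simp only [mem_product, mem_filter, mem_powersetCard] at h ⊢
      obtain ⟨hb, ⟨ht, hc⟩, hp⟩ := h
      rw [insert_inter_B hb ht, insert_inter_X hb ht, card_insert_of_notMem (notMem hb ht), hc]
      exact ⟨⟨⟨insert_subset (mem_union_right _ hb) (ht.trans subset_union_left), rfl⟩, hp,
        by simp⟩, by simp⟩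
    · rintro ⟨b, t⟩ h ⟨b', t'⟩ h' heq
      simp only [mem_product, mem_filter, mem_powersetCard] at h h' heq
      have hB := insert_inter_B h.1 h.2.1.1
      have hX := insert_inter_X h.1 h.2.1.1
      rw [heq, insert_inter_B h'.1 h'.2.1.1] at hB
      rw [heq, insert_inter_X h'.1 h'.2.1.1] at hX
      rw [singleton_injective hB, hX]
    · intro t h
      simp only [mem_filter, mem_powersetCard] at h
      obtain ⟨⟨⟨ht, hc⟩, hp, h1⟩, h0⟩ := h
      obtain ⟨b, hb⟩ := card_eq_one.1
        (le_antisymm h1 (card_pos.2 (nonempty_iff_ne_empty.2 h0)))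
      have hbt : b ∈ t ∩ B := hb ▸ mem_singleton_self b
      have hX : t ∩ X = t.erase b := by
        rw [inter_X ht, ← sdiff_inter_self_left, hb, sdiff_singleton_eq_erase]
      refine ⟨(b, t ∩ X), ?_, ?_⟩
      · simp only [mem_product, mem_filter, mem_powersetCard]
        refine ⟨(mem_inter.1 hbt).2, ⟨inter_subset_right, ?_⟩, hp⟩
        rw [hX, card_erase_of_mem (mem_inter.1 hbt).1, hc, Nat.add_sub_cancel]
      · simp only [hX]
        exact insert_erase (mem_inter.1 hbt).1

/-- The elements of `Fin n` whose value lies in `[a, b)`. -/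
def finIco (n a b : ℕ) : Finset (Fin n) := {i | a ≤ (i : ℕ) ∧ (i : ℕ) < b}

@[simp]
theorem mem_finIco {n a b : ℕ} {i : Fin n} : i ∈ finIco n a b ↔ a ≤ (i : ℕ) ∧ (i : ℕ) < b := by
  simp [finIco]

theorem card_finIco {n a b : ℕ} (h : b ≤ n) : #(finIco n a b) = b - a := by
  have : finIco n a b =
      (Finset.Ico a b).attachFin fun i hi => (Finset.mem_Ico.1 hi).2.trans_le h := by
    ext i
    simp
  rw [this, card_attachFin, Nat.card_Ico]

theorem disjoint_finIco {n a b c d : ℕ} (h : b ≤ c) : Disjoint (finIco n a b) (finIco n c d) := by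
  rw [Finset.disjoint_left]
  intro i
  simp only [mem_finIco]
  omega

theorem finIco_union_finIco {n a b c : ℕ} (hab : a ≤ b) (hbc : b ≤ c) :
    finIco n a b ∪ finIco n b c = finIco n a c := by
  ext i
  simp only [mem_union, mem_finIco]
  omega

theorem finIco_zero_self (n : ℕ) : finIco n 0 n = univ := by
  ext i
  simp

theorem nearJoinGraph_adj {n s : ℕ} (hs : 3 ≤ s) {i j : Fin n} :
    (nearJoinGraph n s).Adj i j ↔ i ≠ j ∧ ¬((i : ℕ) < 2 ∧ (j : ℕ) < 2) ∧
      ¬(s - 1 ≤ (i : ℕ) ∧ s - 1 ≤ (j : ℕ)) := by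
  rw [nearJoinGraph, SimpleGraph.fromRel_adj]
  refine and_congr_right fun _ => ?_
  omega

theorem nearJoinGraph_isClique_iff {n s : ℕ} (hs : 3 ≤ s) {t : Finset (Fin n)} :
    (nearJoinGraph n s).IsClique t ↔
      #(t ∩ finIco n 0 2) ≤ 1 ∧ #(t ∩ finIco n (s - 1) n) ≤ 1 := by
  simp only [card_le_one, mem_inter, mem_finIco, SimpleGraph.isClique_iff, Set.Pairwise,
    mem_coe, nearJoinGraph_adj hs]
  constructor
  · intro h
    refine ⟨fun a ha b hb => ?_, fun a ha b hb => ?_⟩ <;>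
    · by_contra hab
      have := h ha.1 hb.1 hab
      omega
  · rintro ⟨h₁, h₂⟩ a ha b hb hab
    refine ⟨hab, fun h => hab (h₁ a ⟨ha, ?_⟩ b ⟨hb, ?_⟩), fun h => hab (h₂ a ⟨ha, ?_⟩ b ⟨hb, ?_⟩)⟩ <;>
    omega

theorem nearJoinGraph_cliqueFree {n s : ℕ} (hs : 3 ≤ s) (hn : s ≤ n) :
    (nearJoinGraph n s).CliqueFree s := by
  rintro t ⟨ht, hc⟩
  obtain ⟨h₁, h₂⟩ := (nearJoinGraph_isClique_iff hs).1 ht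
  have hsub : t ⊆ finIco n 2 (s - 1) ∪ (t ∩ finIco n 0 2 ∪ t ∩ finIco n (s - 1) n) := by
    intro i hi
    simp only [mem_union, mem_inter, mem_finIco, hi, true_and]
    omega
  have := card_le_card hsub
  have := card_union_le (finIco n 2 (s - 1)) (t ∩ finIco n 0 2 ∪ t ∩ finIco n (s - 1) n)
  have := card_union_le (t ∩ finIco n 0 2) (t ∩ finIco n (s - 1) n)
  have := card_finIco (n := n) (a := 2) (b := s - 1) (by omega)
  omega

theorem addEdge_isClique {G : SimpleGraph V} {u v : V} {t : Set V}
    (h : ∀ a ∈ t, ∀ b ∈ t, a ≠ b → s(a, b) ≠ s(u, v) → G.Adj a b) :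
    (addEdge G u v).IsClique t := by
  intro a ha b hb hab
  by_cases he : s(a, b) = s(u, v)
  · exact Or.inr ⟨by simpa using he, hab⟩
  · exact Or.inl (h a ha b hb hab he)

theorem nearJoinGraph_kSat {n s : ℕ} (hs : 3 ≤ s) (hn : s ≤ n) : KSat s (nearJoinGraph n s) := by
  refine ⟨nearJoinGraph_cliqueFree hs hn, fun u v huv hadj => ?_⟩
  have hval : (u : ℕ) ≠ v := Fin.val_ne_of_ne huv
  have hcases : ((u : ℕ) < 2 ∧ (v : ℕ) < 2) ∨ (s - 1 ≤ (u : ℕ) ∧ s - 1 ≤ (v : ℕ)) := by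
    rw [nearJoinGraph_adj hs] at hadj
    tauto
  rcases hcases with ⟨hu, hv⟩ | ⟨hu, hv⟩
  · refine IsNClique.not_cliqueFree (s := finIco n 0 s) ⟨addEdge_isClique ?_, ?_⟩
    · intro a ha b hb hab he
      simp only [mem_coe, mem_finIco] at ha hb
      rw [nearJoinGraph_adj hs]
      simp only [ne_eq, Sym2.eq_iff, Fin.ext_iff] at hab he ⊢
      omega
    · rw [card_finIco hn, Nat.sub_zero]
  · refine IsNClique.not_cliqueFree (s := insert u (insert v (finIco n 1 (s - 1))))
      ⟨addEdge_isClique ?_, ?_⟩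
    · intro a ha b hb hab he
      rw [nearJoinGraph_adj hs]
      simp only [mem_coe, mem_insert, mem_finIco, ne_eq, Sym2.eq_iff, Fin.ext_iff]
        at ha hb hab he ⊢
      omega
    · rw [card_insert_of_notMem, card_insert_of_notMem, card_finIco (by omega)]
      · omega
      · simp only [mem_finIco]
        omega
      · simp only [mem_insert, mem_finIco, huv, false_or]
        omega

theorem nearJoinGraph_cliqueCount {n s : ℕ} (hs : 3 ≤ s) (hn : s ≤ n) (k : ℕ) :
    cliqueCount (nearJoinGraph n s) (k + 2) =
      (2 * (s - 3).choose k + (s - 3).choose (k + 1)) * (n - s + 1) +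
        2 * (s - 3).choose (k + 1) + (s - 3).choose (k + 2) := by
  have hA : #(finIco n 0 2) = 2 := card_finIco (by omega)
  have hC : #(finIco n 2 (s - 1)) = s - 3 := by rw [card_finIco (by omega)]; omega
  have hI : #(finIco n (s - 1) n) = n - s + 1 := by rw [card_finIco le_rfl]; omega
  have hAC : finIco n 2 (s - 1) ∪ finIco n 0 2 = finIco n 0 (s - 1) := by
    rw [union_comm, finIco_union_finIco (by omega) (by omega)]
  have hcore (m : ℕ) : #{t ∈ powersetCard (m + 1) (finIco n 0 (s - 1)) | #(t ∩ finIco n 0 2) ≤ 1} =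
      (s - 3).choose (m + 1) + 2 * (s - 3).choose m := by
    have := card_powersetCard_union_filter_inter_le_one
      (disjoint_finIco (n := n) (a := 0) (d := s - 1) (le_refl 2)).symm (fun _ => True) m
    simpa [hAC, hA, hC] using this
  have hset : {t : Finset (Fin n) | (nearJoinGraph n s).IsNClique (k + 2) t} =
      ↑({t ∈ powersetCard (k + 1 + 1) (finIco n 0 (s - 1) ∪ finIco n (s - 1) n) |
        #(t ∩ finIco n 0 (s - 1) ∩ finIco n 0 2) ≤ 1 ∧ #(t ∩ finIco n (s - 1) n) ≤ 1} :
          Finset (Finset (Fin n))) := by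
    ext t
    have hsub : finIco n 0 (s - 1) ∩ finIco n 0 2 = finIco n 0 2 :=
      inter_eq_right.2 (hAC ▸ subset_union_right)
    rw [finIco_union_finIco (by omega) (by omega), finIco_zero_self]
    simp only [Set.mem_ofPred_eq, SimpleGraph.isNClique_iff, nearJoinGraph_isClique_iff hs,
      coe_filter, mem_powersetCard, subset_univ, true_and, inter_assoc, hsub]
    tauto
  rw [cliqueCount, hset, Set.ncard_coe_finset,
    card_powersetCard_union_filter_inter_le_one (disjoint_finIco le_rfl)
      (fun t => #(t ∩ finIco n 0 2) ≤ 1), hcore, hcore, hI]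
  ring

/-- Let `s > r ≥ 2` and `n ≥ s`. The join of `K_{s-1}` minus an edge with the
edgeless graph on `n - s + 1` vertices is `K_s`-saturated and has exactly
`(2·C(s-3,r-2) + C(s-3,r-1))·(n-s+1) + 2·C(s-3,r-1) + C(s-3,r)` copies of `K_r`. -/
theorem nearJoin_saturated_cliqueCount (r s n : ℕ) (hr : 2 ≤ r) (hrs : r < s) (hn : s ≤ n) :
    KSat s (nearJoinGraph n s) ∧
      cliqueCount (nearJoinGraph n s) r =
        (2 * (s - 3).choose (r - 2) + (s - 3).choose (r - 1)) * (n - s + 1) +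
          2 * (s - 3).choose (r - 1) + (s - 3).choose r := by
  obtain ⟨k, rfl⟩ := Nat.exists_eq_add_of_le' hr
  exact ⟨nearJoinGraph_kSat (by omega) hn, nearJoinGraph_cliqueCount (by omega) hn k⟩
end
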